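/- arXiv:2402.00924 — 2 statements merged into one kernel-verified Lean document; each statement's English description precedes it below -/
import Mathlib

section
/- Let a, b, m₀, n₁, n₂ be real numbers with a ≠ 0, a·n₁ + b − m₀ > 0 and a·n₂ + b − m₀ > 0; set m₁ = a·n₁ + b, m₂ = a·n₂ + b, let n(τ) = ((a·n₁ + b − m₀)/a)·exp(−a·τ) − (b − m₀)/a be the solution of the cut dynamics with n(0) = n₁, and let Δt = −(1/a)·ln((m₂ − m₀)/(m₁ − m₀)). Then ∫₀^{Δt} n(τ) dτ = −(m₂ − m₁)/a² + ((b − m₀)/a²)·ln((m₂ − m₀)/(m₁ − m₀)); in particular this total time spent on an intermediate cut, traversed from one fixed end accumulation n₁ to the other fixed end n₂, does not depend on the initial disruption magnitude. -/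
/-- The integral of a decaying exponential minus a constant. -/
theorem integral_const_mul_exp_neg_mul_sub_const {a : ℝ} (ha : a ≠ 0) (c d t : ℝ) :
    ∫ τ in (0 : ℝ)..t, (c * Real.exp (-(a * τ)) - d) =
      c / a * (1 - Real.exp (-(a * t))) - d * t := by
  have hderiv : ∀ τ ∈ Set.uIcc 0 t,
      HasDerivAt (fun τ => -(c / a) * Real.exp (-(a * τ)) - d * τ)
        (c * Real.exp (-(a * τ)) - d) τ := fun τ _ => by
    have hlin : HasDerivAt (fun τ => -(a * τ)) (-(a * 1)) τ :=
      ((hasDerivAt_id τ).const_mul a).neg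
    refine ((hlin.exp.const_mul (-(c / a))).sub ((hasDerivAt_id τ).const_mul d)).congr_deriv ?_
    field_simp
  rw [intervalIntegral.integral_eq_sub_of_hasDerivAt hderiv
    (Continuous.intervalIntegrable (by fun_prop) _ _)]
  simp only [mul_zero, neg_zero, Real.exp_zero]
  ring

/-- The total time spent on an intermediate cut, traversed from the fixed end
accumulation `n₁` (completion `m₁ = a·n₁ + b`) to the other fixed end `n₂`
(completion `m₂ = a·n₂ + b`) in time `Δt = -(1/a)·ln((m₂ - m₀)/(m₁ - m₀))`,
equals `-(m₂ - m₁)/a² + ((b - m₀)/a²)·ln((m₂ - m₀)/(m₁ - m₀))`; in particular it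
does not depend on the initial disruption magnitude. -/
theorem stmt_7 (a b m₀ n₁ n₂ : ℝ) (ha : a ≠ 0)
    (h₁ : a * n₁ + b - m₀ > 0) (h₂ : a * n₂ + b - m₀ > 0)
    (m₁ m₂ : ℝ) (hm₁ : m₁ = a * n₁ + b) (hm₂ : m₂ = a * n₂ + b)
    (n : ℝ → ℝ)
    (hn : ∀ τ, n τ = ((a * n₁ + b - m₀) / a) * Real.exp (-(a * τ)) - (b - m₀) / a)
    (Δt : ℝ) (hΔt : Δt = -(1 / a) * Real.log ((m₂ - m₀) / (m₁ - m₀))) :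
    ∫ τ in (0 : ℝ)..Δt, n τ =
      -(m₂ - m₁) / a ^ 2 + ((b - m₀) / a ^ 2) * Real.log ((m₂ - m₀) / (m₁ - m₀)) := by
  subst hm₁ hm₂
  have hexp : Real.exp (-(a * Δt)) = (a * n₂ + b - m₀) / (a * n₁ + b - m₀) := by
    rw [← Real.exp_log (div_pos h₂ h₁), hΔt]
    congr 1
    field_simp
  simp only [hn]
  rw [integral_const_mul_exp_neg_mul_sub_const ha, hexp, hΔt]
  have h₁' := h₁.ne'
  generalize Real.log _ = L
  field_simp
  ring
end

section
/- Let y < z be integers and let a_i, b_i (y ≤ i ≤ z) be reals such that every a_i is nonzero and a_y < a_{y+1} < ⋯ < a_z. For y ≤ i ≤ z−1 define n_{c,i} = (b_i − b_{i+1})/(a_{i+1} − a_i) and m_{c,i} = a_i·n_{c,i} + b_i, and assume n_{c,y} ≥ n_{c,y+1} ≥ ⋯ ≥ n_{c,z−1} ≥ 0. Let m₀ be real with m_{c,i} − m₀ > 0 for all y ≤ i ≤ z−1, let m′ be real with m′ − m₀ > 0, set P = (m_{c,y} − m₀)^{−a_z/a_y} · Π_{i=y+1}^{z−1} ((m_{c,i}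 − m₀)/(m_{c,i−1} − m₀))^{−a_z/a_i} and t_{c,z−1} = −(1/a_y)·ln((m_{c,y} − m₀)/(m′ − m₀)) − Σ_{i=y+1}^{z−1} (1/a_i)·ln((m_{c,i} − m₀)/(m_{c,i−1} − m₀)), and let t > t_{c,z−1}. Then b_y − m₀ − (exp(−a_z·t)·P/a_z)·(a_z − a_y)·(m_{c,z−1} − m₀)·(m′ − m₀)^{a_z/a_y} − a_y·(b_z − m₀)/a_z > 0; consequently the second derivative of the total time spent with respect to the disruption accumulation, which equals this quantity times (m′ − m₀)^{−2}, is strictly positive (Proposition 1: road transportation networks are fragile under demand disruptions). -/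
/-- A real sequence increasing along the steps of an integer interval is monotone on it. -/
theorem le_of_forall_le_succ_of_mem_Icc {f : ℤ → ℝ} {p q : ℤ}
    (h : ∀ i, p ≤ i → i < q → f i ≤ f (i + 1)) {i j : ℤ} (hi : p ≤ i) (hij : i ≤ j)
    (hj : j ≤ q) : f i ≤ f j := by
  induction j, hij using Int.leInduction with
  | base => exact le_rfl
  | succ k hk ih => exact (ih (by lia)).trans (h k (by lia) (by lia))

/-- A weighted product of powers of positive reals as an exponential of a sum of logarithms. -/
theorem prod_rpow_neg_div_eq_exp {ι : Type*} (s : Finset ι) (r a : ι → ℝ) (c : ℝ)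
    (hr : ∀ i ∈ s, 0 < r i) :
    ∏ i ∈ s, r i ^ (-(c / a i)) = Real.exp (-(c * ∑ i ∈ s, (1 / a i) * Real.log (r i))) := by
  rw [Finset.mul_sum, ← Finset.sum_neg_distrib, Real.exp_sum]
  refine Finset.prod_congr rfl fun i hi => ?_
  rw [Real.rpow_def_of_pos (hr i hi)]
  congr 1
  ring

/-- The exponential decay `exp (-c u)` makes `(1 - exp (-c u)) / c` positive, whatever the sign
of `c`. -/
theorem exp_neg_mul_div_lt_one_div {c u : ℝ} (hc : c ≠ 0) (hu : 0 < u) :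
    Real.exp (-(c * u)) / c < 1 / c := by
  rcases lt_or_gt_of_ne hc with h | h
  · exact div_lt_div_of_neg_of_lt h (Real.one_lt_exp_iff.2 (by nlinarith))
  · exact div_lt_div_of_pos_right (Real.exp_lt_one_iff.2 (by nlinarith)) h

open Finset in
/-- Proposition 1: road transportation networks are fragile under demand
disruptions. For a Method-of-Cuts MFD with cuts `m = a_i·n + b_i`
(`i = y, …, z`, strictly increasing slopes), the quantity
`b_y - m₀ - (exp(-a_z·t)·P/a_z)·(a_z - a_y)·(m_{c,z-1} - m₀)·(m′ - m₀)^(a_z/a_y)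
  - a_y·(b_z - m₀)/a_z`
is strictly positive, hence the second derivative of the total time spent with
respect to the disruption accumulation, which equals this quantity times
`(m′ - m₀)⁻²`, is strictly positive. -/
theorem stmt_11 (y z : ℤ) (hyz : y < z) (a b : ℤ → ℝ)
    (ha : ∀ i ∈ Finset.Icc y z, a i ≠ 0)
    (hmono : ∀ i, y ≤ i → i < z → a i < a (i + 1))
    (n_c m_c : ℤ → ℝ)
    (hn_c : ∀ i ∈ Finset.Icc y (z - 1), n_c i = (b i - b (i + 1)) / (a (i + 1) - a i))
    (hm_c : ∀ i ∈ Finset.Icc y (z - 1), m_c i = a i * n_c i + b i)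
    (hanti : ∀ i, y ≤ i → i < z - 1 → n_c (i + 1) ≤ n_c i)
    (hlast : 0 ≤ n_c (z - 1))
    (m₀ m' : ℝ)
    (hmc : ∀ i ∈ Finset.Icc y (z - 1), m_c i - m₀ > 0)
    (hm' : m' - m₀ > 0)
    (P t_c t : ℝ)
    (hP : P = (m_c y - m₀) ^ (-(a z / a y))
        * ∏ i ∈ Finset.Icc (y + 1) (z - 1),
            ((m_c i - m₀) / (m_c (i - 1) - m₀)) ^ (-(a z / a i)))
    (ht_c : t_c = -(1 / a y) * Real.log ((m_c y - m₀) / (m' - m₀))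
        - ∑ i ∈ Finset.Icc (y + 1) (z - 1),
            (1 / a i) * Real.log ((m_c i - m₀) / (m_c (i - 1) - m₀)))
    (ht : t > t_c) :
    0 < b y - m₀
        - (Real.exp (-(a z * t)) * P / a z) * (a z - a y) * (m_c (z - 1) - m₀)
            * (m' - m₀) ^ (a z / a y)
        - a y * (b z - m₀) / a z ∧
    0 < (b y - m₀
        - (Real.exp (-(a z * t)) * P / a z) * (a z - a y) * (m_c (z - 1) - m₀)
            * (m' - m₀) ^ (a z / a y)
        - a y * (b z - m₀) / a z) * (m' - m₀)⁻¹ ^ 2 := by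
  have hyP : 0 < m_c y - m₀ := hmc y (by simp; lia)
  have haz : a z ≠ 0 := ha z (by simp; lia)
  have hlt : a y < a z :=
    (hmono y le_rfl hyz).trans_le (le_of_forall_le_succ_of_mem_Icc
      (fun i hi hiz => (hmono i hi hiz).le) (by lia) (by lia) le_rfl)
  have hE : Real.exp (-(a z * t)) * P * (m' - m₀) ^ (a z / a y)
      = Real.exp (-(a z * (t - t_c))) := by
    rw [hP, prod_rpow_neg_div_eq_exp _ _ _ _ fun i hi => ?_, Real.rpow_def_of_pos hyP,
      Real.rpow_def_of_pos hm', ← Real.exp_add, ← Real.exp_add, ← Real.exp_add, ht_c,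
      Real.log_div hyP.ne' hm'.ne']
    · congr 1
      ring
    · rw [Finset.mem_Icc] at hi
      exact div_pos (hmc i (by simp; lia)) (hmc (i - 1) (by simp; lia))
  -- the cuts, evaluated at the last critical accumulation, decrease with the index
  have hstep : ∀ i, y ≤ i → i < z →
      a (i + 1) * n_c (z - 1) + b (i + 1) ≤ a i * n_c (z - 1) + b i := by
    intro i hi hiz
    have hn : n_c (z - 1) ≤ n_c i := by
      have := le_of_forall_le_succ_of_mem_Icc (f := fun j => -n_c j) (p := y) (q := z - 1)
        (fun j hj hjz => neg_le_neg (hanti j hj hjz)) hi (by lia : i ≤ z - 1) le_rfl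
      exact neg_le_neg_iff.1 this
    have hpos : 0 < a (i + 1) - a i := sub_pos.2 (hmono i hi hiz)
    rw [hn_c i (by simp; lia), le_div_iff₀ hpos] at hn
    linarith
  have hlast_cut : m_c (z - 1) = a (z - 1) * n_c (z - 1) + b (z - 1) := hm_c _ (by simp; lia)
  have hz_cut : m_c (z - 1) = a z * n_c (z - 1) + b z := by
    have hpos : 0 < a (z - 1 + 1) - a (z - 1) := sub_pos.2 (hmono (z - 1) (by lia) (by lia))
    have hn := hn_c (z - 1) (by simp; lia)
    rw [eq_div_iff hpos.ne', sub_add_cancel] at hn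
    linarith
  have hcut : m_c (z - 1) ≤ a y * n_c (z - 1) + b y := by
    have := le_of_forall_le_succ_of_mem_Icc (f := fun j => -(a j * n_c (z - 1) + b j))
      (p := y) (q := z) (fun j hj hjz => neg_le_neg (hstep j hj hjz)) le_rfl hyz.le le_rfl
    rw [hz_cut]
    exact neg_le_neg_iff.1 this
  have hdecay := mul_lt_mul_of_pos_right (exp_neg_mul_div_lt_one_div haz (sub_pos.2 ht))
    (mul_pos (sub_pos.2 hlt) (hmc (z - 1) (by simp; lia)))
  have hlimit : b y - m₀ - 1 / a z * ((a z - a y) * (m_c (z - 1) - m₀)) - a y * (b z - m₀) / a z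
      = a y * n_c (z - 1) + b y - m_c (z - 1) := by
    rw [hz_cut]
    field_simp
    ring
  have hrw : Real.exp (-(a z * t)) * P / a z * (a z - a y) * (m_c (z - 1) - m₀)
      * (m' - m₀) ^ (a z / a y)
      = Real.exp (-(a z * (t - t_c))) / a z * ((a z - a y) * (m_c (z - 1) - m₀)) := by
    rw [← hE]
    ring
  have hmain : 0 < b y - m₀
      - (Real.exp (-(a z * t)) * P / a z) * (a z - a y) * (m_c (z - 1) - m₀)
          * (m' - m₀) ^ (a z / a y)
      - a y * (b z - m₀) / a z := by
    rw [hrw]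
    linarith
  exact ⟨hmain, mul_pos hmain (pow_pos (inv_pos.2 hm') 2)⟩
end
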